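/- Assume additionally that the map x ∈ K₀ ↦ 𝔸^x := {(h,z) ∈ H×ℝᵐ : z ∈ A_{(h,x)}} is continuous for the Hausdorff distance on nonempty compact subsets of H×ℝᵐ. For each integer k ≥ 1 let δ_k := inf{ δ > 0 : dist(y_{ε_k}(t₀/ε_k), A^{x₀(t₀)}_{g·(t₀/ε_k)}[δ]) ≤ δ }, where A^x_h[δ] := ⋃{A_{(h̃,x)} : h̃ ∈ H, d(h̃,h) ≤ δ}. Then (i) lim_{k→∞} δ_k = 0 and (ii) lim_{k→∞} dist(y_{ε_k}(t₀/ε_k), A^{x₀(t₀)}_{g·(t₀/ε_k)}[δ_k]) = 0. -/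

import Mathlib

open Filter Topology Metric Set

noncomputable section

/-- The time-translate h·s of a map, as a continuous map. -/
def timeTranslate {n m : ℕ} (s : ℝ)
    (h : C(EuclideanSpace ℝ (Fin n) × EuclideanSpace ℝ (Fin m) × ℝ,
      EuclideanSpace ℝ (Fin m))) :
    C(EuclideanSpace ℝ (Fin n) × EuclideanSpace ℝ (Fin m) × ℝ,
      EuclideanSpace ℝ (Fin m)) :=
  ⟨fun p => h (p.1, p.2.1, p.2.2 + s), h.continuous.comp (by fun_prop)⟩

/-- Admissibility: bounded and uniformly continuous on K × ℝ for every compact K. -/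
def IsAdmissibleMap {n m : ℕ}
    (g : C(EuclideanSpace ℝ (Fin n) × EuclideanSpace ℝ (Fin m) × ℝ,
      EuclideanSpace ℝ (Fin m))) : Prop :=
  ∀ K : Set (EuclideanSpace ℝ (Fin n) × EuclideanSpace ℝ (Fin m)), IsCompact K →
    (∃ C : ℝ, ∀ x y (τ : ℝ), (x, y) ∈ K → ‖g (x, y, τ)‖ ≤ C) ∧
    (∀ ε > (0:ℝ), ∃ δ > (0:ℝ), ∀ x y (τ : ℝ) x' y' (τ' : ℝ), (x, y) ∈ K → (x', y') ∈ K →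
      dist ((x, y, τ) : EuclideanSpace ℝ (Fin n) × EuclideanSpace ℝ (Fin m) × ℝ)
        (x', y', τ') < δ → dist (g (x, y, τ)) (g (x', y', τ')) < ε)

/-- Uniform Lipschitz continuity in y on compact sets. -/
def IsLipschitzInY {n m : ℕ}
    (g : C(EuclideanSpace ℝ (Fin n) × EuclideanSpace ℝ (Fin m) × ℝ,
      EuclideanSpace ℝ (Fin m))) : Prop :=
  ∀ K₀ : Set (EuclideanSpace ℝ (Fin n)), IsCompact K₀ →
    ∀ K : Set (EuclideanSpace ℝ (Fin m)), IsCompact K →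
      ∃ L > (0:ℝ), ∀ x ∈ K₀, ∀ y₁ ∈ K, ∀ y₂ ∈ K, ∀ τ : ℝ,
        ‖g (x, y₁, τ) - g (x, y₂, τ)‖ ≤ L * ‖y₁ - y₂‖

/-- The compact tubular neighbourhood K₀ of the slow limit x₀. -/
def slowTube {n : ℕ} (x0 : ℝ → EuclideanSpace ℝ (Fin n)) (t₀ r : ℝ) :
    Set (EuclideanSpace ℝ (Fin n)) :=
  {z | ∃ t ∈ Set.Icc (0:ℝ) t₀, ∃ v : EuclideanSpace ℝ (Fin n), ‖v‖ ≤ r ∧ z = x0 t + v}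

/-- The fiber A_{(h,x)}: initial values of bounded entire solutions of y' = h(x,y,τ). -/
def attrFiber {n m : ℕ} {H : Type*}
    (ev : H → C(EuclideanSpace ℝ (Fin n) × EuclideanSpace ℝ (Fin m) × ℝ,
      EuclideanSpace ℝ (Fin m)))
    (h : H) (x : EuclideanSpace ℝ (Fin n)) : Set (EuclideanSpace ℝ (Fin m)) :=
  {z | ∃ y : ℝ → EuclideanSpace ℝ (Fin m), y 0 = z ∧ (∃ C, ∀ τ : ℝ, ‖y τ‖ ≤ C) ∧
    ∀ τ : ℝ, HasDerivAt y (ev h (x, y τ, τ)) τ}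

/-- The parametrically inflated fiber A_{(h,x)}[δ] over the base H × K₀. -/
def inflFiber {n m : ℕ} {H : Type*} [MetricSpace H]
    (ev : H → C(EuclideanSpace ℝ (Fin n) × EuclideanSpace ℝ (Fin m) × ℝ,
      EuclideanSpace ℝ (Fin m)))
    (K₀ : Set (EuclideanSpace ℝ (Fin n)))
    (h : H) (x : EuclideanSpace ℝ (Fin n)) (δ : ℝ) : Set (EuclideanSpace ℝ (Fin m)) :=
  ⋃ p ∈ {p : H × EuclideanSpace ℝ (Fin n) |
    p.2 ∈ K₀ ∧ max (dist h p.1) (dist x p.2) ≤ δ}, attrFiber ev p.1 p.2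

/-- The inflated fiber Aˣ_h[δ] (inflation only in the hull variable). -/
def inflFiberH {n m : ℕ} {H : Type*} [MetricSpace H]
    (ev : H → C(EuclideanSpace ℝ (Fin n) × EuclideanSpace ℝ (Fin m) × ℝ,
      EuclideanSpace ℝ (Fin m)))
    (h : H) (x : EuclideanSpace ℝ (Fin n)) (δ : ℝ) : Set (EuclideanSpace ℝ (Fin m)) :=
  ⋃ h' ∈ {h' : H | dist h' h ≤ δ}, attrFiber ev h' x

/-- The omega-limit set O(g₀) of g₀ for the flow σf. -/
def omegaSet {H : Type*} [TopologicalSpace H] (σf : ℝ → H → H) (g0 : H) : Set H :=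
  ⋂ s ∈ Set.Ici (0:ℝ), closure {h : H | ∃ τ ≥ s, h = σf τ g0}

/-- The parametrically inflated fiber over the base O(g) × K₀. -/
def inflFiberO {n m : ℕ} {H : Type*} [MetricSpace H]
    (ev : H → C(EuclideanSpace ℝ (Fin n) × EuclideanSpace ℝ (Fin m) × ℝ,
      EuclideanSpace ℝ (Fin m)))
    (σf : ℝ → H → H) (g0 : H)
    (K₀ : Set (EuclideanSpace ℝ (Fin n)))
    (h : H) (x : EuclideanSpace ℝ (Fin n)) (δ : ℝ) : Set (EuclideanSpace ℝ (Fin m)) :=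
  ⋃ p ∈ {p : H × EuclideanSpace ℝ (Fin n) |
    p.1 ∈ omegaSet σf g0 ∧ p.2 ∈ K₀ ∧ max (dist h p.1) (dist x p.2) ≤ δ},
      attrFiber ev p.1 p.2

end

/-- Lipschitz continuity in the state variable on balls, for each frozen parameter. -/
def LipschitzInState {E Y : Type*} [TopologicalSpace E] [NormedAddCommGroup Y]
    (h : C(E × Y × ℝ, Y)) : Prop :=
  ∀ (x : E) (R : ℝ), ∃ L : NNReal, ∀ t : ℝ,
    LipschitzOnWith L (fun y => h (x, y, t)) (closedBall 0 R)

/-- `u` solves `u' = h (X t, u, t)` at every time of `s`. -/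
def IsSolutionOn {E Y : Type*} [TopologicalSpace E] [NormedAddCommGroup Y] [NormedSpace ℝ Y]
    (h : C(E × Y × ℝ, Y)) (X : ℝ → E) (u : ℝ → Y) (s : Set ℝ) : Prop :=
  ∀ t ∈ s, HasDerivAt u (h (X t, u t, t)) t

theorem IsCompact.exists_tendsto_ultrafilter {ι α : Type*} [TopologicalSpace α] {K : Set α}
    (hK : IsCompact K) (U : Ultrafilter ι) {f : ι → α} (hf : ∀ᶠ i in (U : Filter ι), f i ∈ K) :
    ∃ p ∈ K, Tendsto f U (𝓝 p) :=
  hK.ultrafilter_le_nhds (U.map f) (le_principal_iff.2 hf)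

section GeneralODE

variable {E Y ι : Type*} [NormedAddCommGroup E] [NormedAddCommGroup Y] [NormedSpace ℝ Y]

theorem IsSolutionOn.mono {h : C(E × Y × ℝ, Y)} {X : ℝ → E} {u : ℝ → Y} {s t : Set ℝ}
    (hu : IsSolutionOn h X u t) (hst : s ⊆ t) : IsSolutionOn h X u s :=
  fun τ hτ => hu τ (hst hτ)

theorem IsSolutionOn.continuousOn {h : C(E × Y × ℝ, Y)} {X : ℝ → E} {u : ℝ → Y} {s : Set ℝ}
    (hu : IsSolutionOn h X u s) : ContinuousOn u s :=
  fun τ hτ => (hu τ hτ).continuousAt.continuousWithinAt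

theorem gronwallBound_self_eq_mul (θ L x : ℝ) :
    gronwallBound θ L θ x = θ * gronwallBound 1 L 1 x := by
  unfold gronwallBound
  split_ifs <;> ring

/-- The first exit time argument: a trajectory which solves an ODE up to an error stays close to an
exact one, as long as the field is Lipschitz in a unit neighbourhood of the exact trajectory. -/
theorem dist_lt_of_approx_trajectory {V : ℝ → Y → Y} {u v u' : ℝ → Y} {T₀ S M θ η : ℝ}
    {L : NNReal} (hV : ∀ t, LipschitzOnWith L (V t) (closedBall 0 (M + 1)))
    (hv : ∀ t ∈ Icc T₀ S, HasDerivAt v (V t (v t)) t) (hvM : ∀ t ∈ Icc T₀ S, ‖v t‖ ≤ M)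
    (hu : ∀ t ∈ Icc T₀ S, HasDerivAt u (u' t) t)
    (huV : ∀ t ∈ Icc T₀ S, ‖u t‖ ≤ M + 1 → dist (u' t) (V t (u t)) ≤ θ)
    (hθ : 0 ≤ θ) (h0 : dist (u T₀) (v T₀) ≤ θ) (hη : η ≤ 1)
    (hG : gronwallBound θ L θ (S - T₀) < η) :
    ∀ t ∈ Icc T₀ S, dist (u t) (v t) < η := by
  by_contra! hcon
  obtain ⟨t, ht, htη⟩ := hcon
  have hcu : ContinuousOn u (Icc T₀ S) := fun s hs => (hu s hs).continuousAt.continuousWithinAt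
  have hcv : ContinuousOn v (Icc T₀ S) := fun s hs => (hv s hs).continuousAt.continuousWithinAt
  have hB : IsCompact (Icc T₀ S ∩ {s | η ≤ dist (u s) (v s)}) := by
    have : IsClosed (Icc T₀ S ∩ (fun s => dist (u s) (v s)) ⁻¹' Ici η) :=
      (continuous_dist.comp_continuousOn (hcu.prodMk hcv)).preimage_isClosed_of_isClosed isClosed_Icc isClosed_Ici
    exact isCompact_Icc.of_isClosed_subset this inter_subset_left
  obtain ⟨s, ⟨hs, hsη⟩, hmin⟩ := hB.exists_isLeast ⟨t, ht, htη⟩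
  have hlt : ∀ τ ∈ Ico T₀ s, τ ∈ Icc T₀ S ∧ dist (u τ) (v τ) < η := by
    intro τ hτ
    have hm : τ ∈ Icc T₀ S := ⟨hτ.1, hτ.2.le.trans hs.2⟩
    refine ⟨hm, ?_⟩
    by_contra! hc
    exact absurd (hmin ⟨hm, hc⟩) (not_le.2 hτ.2)
  have hball : ∀ τ ∈ Ico T₀ s, ‖u τ‖ ≤ M + 1 := by
    intro τ hτ
    have h1 := (hlt τ hτ).2
    have h2 := hvM τ (hlt τ hτ).1
    rw [dist_eq_norm] at h1
    have h3 := norm_add_le (u τ - v τ) (v τ)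
    rw [sub_add_cancel] at h3
    linarith
  have hsub : Icc T₀ s ⊆ Icc T₀ S := Icc_subset_Icc_right hs.2
  have key := dist_le_of_approx_trajectories_ODE_of_mem (v := V)
    (s := fun _ => closedBall 0 (M + 1)) (K := L) (f := u) (g := v) (f' := u')
    (g' := fun t => V t (v t)) (a := T₀) (b := s) (εf := θ) (εg := 0) (δ := θ)
    (fun τ _ => hV τ) (hcu.mono hsub) (fun τ hτ => (hu τ (hlt τ hτ).1).hasDerivWithinAt)
    (fun τ hτ => huV τ (hlt τ hτ).1 (hball τ hτ))
    (fun τ hτ => by simpa using hball τ hτ) (hcv.mono hsub)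
    (fun τ hτ => (hv τ (hlt τ hτ).1).hasDerivWithinAt) (fun τ _ => by simp)
    (fun τ hτ => by
      have := hvM τ (hlt τ hτ).1
      simp only [mem_closedBall, dist_zero_right]
      linarith) h0 s ⟨hs.1, le_rfl⟩
  rw [add_zero] at key
  have hmono := gronwallBound_mono hθ hθ L.coe_nonneg (sub_le_sub_right hs.2 T₀)
  have hsη' : η ≤ dist (u s) (v s) := hsη
  linarith

variable [ProperSpace E] [ProperSpace Y]

/-- Continuous dependence on the field, the parameter and the initial value. -/
theorem eventually_dist_le_of_isSolutionOn {l : Filter ι} {h : C(E × Y × ℝ, Y)}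
    (hL : LipschitzInState h) {T₀ T₁ : ℝ} {x : E} {v : ℝ → Y}
    (hv : IsSolutionOn h (fun _ => x) v (Icc T₀ T₁)) {hi : ι → C(E × Y × ℝ, Y)}
    (hhi : Tendsto hi l (𝓝 h)) {S : ι → ℝ} (hS : ∀ i, S i ≤ T₁) {X : ι → ℝ → E}
    (hX : ∀ η > 0, ∀ᶠ i in l, ∀ t ∈ Icc T₀ (S i), dist (X i t) x ≤ η) {u : ι → ℝ → Y}
    (hu : ∀ᶠ i in l, IsSolutionOn (hi i) (X i) (u i) (Icc T₀ (S i)))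
    (h0 : Tendsto (fun i => u i T₀) l (𝓝 (v T₀))) :
    ∀ η > 0, ∀ᶠ i in l, ∀ t ∈ Icc T₀ (S i), dist (u i t) (v t) ≤ η := by
  intro η hη
  obtain ⟨M, hM⟩ := isCompact_Icc.exists_bound_of_continuousOn hv.continuousOn
  obtain ⟨L, hLip⟩ := hL x (M + 1)
  obtain ⟨θ, hθ, hG⟩ : ∃ θ > 0, gronwallBound θ L θ (T₁ - T₀) < min η 1 := by
    have ht : Tendsto (fun θ : ℝ => θ * gronwallBound 1 L 1 (T₁ - T₀)) (𝓝[>] 0) (𝓝 0) := by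
      have : Tendsto (fun θ : ℝ => θ * gronwallBound 1 L 1 (T₁ - T₀)) (𝓝 0)
          (𝓝 (0 * gronwallBound 1 L 1 (T₁ - T₀))) := tendsto_id.mul_const _
      rw [zero_mul] at this
      exact this.mono_left nhdsWithin_le_nhds
    obtain ⟨θ, h1, h2⟩ := ((ht.eventually_lt_const (lt_min hη one_pos)).and
      self_mem_nhdsWithin).exists
    exact ⟨θ, h2, by rwa [gronwallBound_self_eq_mul]⟩
  have hK : IsCompact (closedBall x 1 ×ˢ closedBall (0 : Y) (M + 1) ×ˢ Icc T₀ T₁) :=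
    (isCompact_closedBall _ _).prod ((isCompact_closedBall _ _).prod isCompact_Icc)
  have hunif := Metric.tendstoUniformlyOn_iff.1
    (ContinuousMap.tendsto_iff_forall_isCompact_tendstoUniformlyOn.1 hhi _ hK) (θ / 2) (half_pos hθ)
  obtain ⟨δ, hδ, huc⟩ := Metric.uniformContinuousOn_iff.1
    (hK.uniformContinuousOn_of_continuous h.continuous.continuousOn) (θ / 2) (half_pos hθ)
  filter_upwards [hunif, hX (min (δ / 2) 1) (by positivity), hu,
    Metric.tendsto_nhds.1 h0 θ hθ] with i hi1 hi2 hi3 hi4 t ht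
  have hsub : Icc T₀ (S i) ⊆ Icc T₀ T₁ := Icc_subset_Icc_right (hS i)
  refine (lt_of_lt_of_le (dist_lt_of_approx_trajectory (V := fun t y => h (x, y, t))
    (u' := fun t => hi i (X i t, u i t, t)) (fun t => hLip t)
    (hv.mono hsub) (fun s hs => hM s (hsub hs)) hi3 ?_ hθ.le hi4.le (min_le_right η 1) ?_ t ht)
    (min_le_left _ _)).le
  · intro s hs hsM
    have hx := hi2 s hs
    have hx1 : dist (X i s) x ≤ 1 := hx.trans (min_le_right _ _)
    have hx2 : dist (X i s) x ≤ δ / 2 := hx.trans (min_le_left _ _)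
    have hm1 : (X i s, u i s, s) ∈ closedBall x 1 ×ˢ closedBall (0 : Y) (M + 1) ×ˢ Icc T₀ T₁ :=
      ⟨hx1, by simpa using hsM, hsub hs⟩
    have hm2 : (x, u i s, s) ∈ closedBall x 1 ×ˢ closedBall (0 : Y) (M + 1) ×ˢ Icc T₀ T₁ :=
      ⟨by simp, by simpa using hsM, hsub hs⟩
    have e1 := hi1 _ hm1
    have e2 := huc _ hm1 _ hm2 (by
      rw [Prod.dist_eq, dist_self, max_eq_left dist_nonneg]
      change dist (X i s) x < δ
      linarith)
    rw [dist_comm] at e1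
    calc dist (hi i (X i s, u i s, s)) (h (x, u i s, s))
        ≤ dist (hi i (X i s, u i s, s)) (h (X i s, u i s, s))
          + dist (h (X i s, u i s, s)) (h (x, u i s, s)) := dist_triangle _ _ _
      _ ≤ θ := by linarith
  · exact (gronwallBound_mono hθ.le hθ.le L.coe_nonneg (sub_le_sub_right (hS i) T₀)).trans_lt hG

theorem IsSolutionOn.eqOn_of_eq_left {h : C(E × Y × ℝ, Y)} (hL : LipschitzInState h) {x : E}
    {T₀ T₁ : ℝ} {u v : ℝ → Y} (hu : IsSolutionOn h (fun _ => x) u (Icc T₀ T₁))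
    (hv : IsSolutionOn h (fun _ => x) v (Icc T₀ T₁)) (h0 : u T₀ = v T₀) :
    EqOn u v (Icc T₀ T₁) := by
  intro t ht
  refine dist_le_zero.1 (le_of_forall_pos_le_add fun η hη => ?_)
  have := eventually_dist_le_of_isSolutionOn (ι := Unit) (l := pure ()) hL hv
    (hi := fun _ => h) tendsto_const_nhds (S := fun _ => T₁) (fun _ => le_rfl)
    (X := fun _ _ => x) (fun η hη => by simp [hη.le]) (u := fun _ => u)
    (by simpa using hu) (by rw [h0]; exact tendsto_const_nhds) η hη
  rw [eventually_pure] at this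
  simpa using this t ht

/-- Limits along an ultrafilter of solutions which are bounded on growing intervals `[-N, 0]` are
bounded entire solutions of the limit equation. -/
theorem exists_entire_solution_of_ultrafilter {U : Ultrafilter ι} {h : C(E × Y × ℝ, Y)}
    (hL : LipschitzInState h) {x : E}
    (hex : ∀ (τ : ℝ) (y₀ : Y), ∃ u : ℝ → Y, u τ = y₀ ∧ IsSolutionOn h (fun _ => x) u (Ici τ))
    (hbd : ∀ u : ℝ → Y, IsSolutionOn h (fun _ => x) u (Ici 0) → ∃ C, ∀ t ≥ 0, ‖u t‖ ≤ C)
    {hi : ι → C(E × Y × ℝ, Y)} (hhi : Tendsto hi U (𝓝 h)) {X : ι → ℝ → E}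
    (hX : ∀ N, ∀ η > 0, ∀ᶠ i in U, ∀ t ∈ Icc (-N) 0, dist (X i t) x ≤ η) {u : ι → ℝ → Y}
    (hu : ∀ N, ∀ᶠ i in U, IsSolutionOn (hi i) (X i) (u i) (Icc (-N) 0)) {D : ℝ}
    (hD : ∀ N, ∀ᶠ i in U, ∀ t ∈ Icc (-N) 0, ‖u i t‖ ≤ D) :
    ∃ y : ℝ → Y, Tendsto (fun i => u i 0) U (𝓝 (y 0)) ∧ (∃ C, ∀ t, ‖y t‖ ≤ C) ∧
      IsSolutionOn h (fun _ => x) y univ := by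
  have hlim : ∀ t : ℝ, ∃ p, t ≤ 0 → ‖p‖ ≤ D ∧ Tendsto (fun i => u i t) U (𝓝 p) := by
    intro t
    by_cases ht : t ≤ 0
    · have hmem : ∀ᶠ i in (U : Filter ι), u i t ∈ closedBall (0 : Y) D := by
        filter_upwards [hD (-t)] with i hi
        simpa using hi t ⟨by simp, ht⟩
      obtain ⟨p, hp, hlp⟩ := (isCompact_closedBall (0 : Y) D).exists_tendsto_ultrafilter U hmem
      exact ⟨p, fun _ => ⟨by simpa using hp, hlp⟩⟩
    · exact ⟨0, fun h => absurd h ht⟩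
  choose v hv using hlim
  have hw : ∀ N : ℝ, ∃ w : ℝ → Y, w (-N) = v (-N) ∧ IsSolutionOn h (fun _ => x) w (Ici (-N)) :=
    fun N => hex (-N) (v (-N))
  choose w hw0 hw using hw
  have hwv : ∀ N : ℝ, 0 ≤ N → ∀ t ∈ Icc (-N) 0, w N t = v t := by
    intro N hN t ht
    have hcd := eventually_dist_le_of_isSolutionOn hL ((hw N).mono Icc_subset_Ici_self) hhi
      (S := fun _ => 0) (fun _ => le_rfl) (hX N) (hu N)
      (by rw [hw0]; exact (hv (-N) (by linarith)).2)
    have htw : Tendsto (fun i => u i t) U (𝓝 (w N t)) := by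
      rw [Metric.tendsto_nhds]
      intro η hη
      filter_upwards [hcd (η / 2) (half_pos hη)] with i hi
      linarith [hi t ht]
    exact tendsto_nhds_unique htw (hv t ht.2).2
  set y : ℝ → Y := fun t => if t ≤ 0 then v t else w 0 t with hy
  have hyw : ∀ N : ℝ, 0 ≤ N → ∀ t ≥ -N, y t = w N t := by
    intro N hN t ht
    rcases le_or_gt t 0 with h0 | h0
    · simp only [hy, if_pos h0]
      exact (hwv N hN t ⟨ht, h0⟩).symm
    · simp only [hy, if_neg (not_le.2 h0)]
      refine IsSolutionOn.eqOn_of_eq_left hL (T₀ := 0) (T₁ := t) ((hw 0).mono ?_)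
        ((hw N).mono ?_) ?_ ⟨h0.le, le_rfl⟩
      · rw [neg_zero]; exact Icc_subset_Ici_self
      · exact fun s hs => le_trans (by linarith : -N ≤ 0) hs.1
      · rw [hwv 0 le_rfl 0 (by simp), hwv N hN 0 ⟨by linarith, le_rfl⟩]
  refine ⟨y, ?_, ?_, ?_⟩
  · simp only [hy, le_refl, if_true]
    exact (hv 0 le_rfl).2
  · obtain ⟨C, hC⟩ := hbd (w 0) (by simpa using hw 0)
    refine ⟨max D C, fun t => ?_⟩
    rcases le_or_gt t 0 with h0 | h0
    · simp only [hy, if_pos h0]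
      exact (hv t h0).1.trans (le_max_left _ _)
    · simp only [hy, if_neg (not_le.2 h0)]
      exact (hC t h0.le).trans (le_max_right _ _)
  · intro t _
    have hlt : -(|t| + 1) < t := by linarith [neg_abs_le t]
    have hN : 0 ≤ |t| + 1 := by positivity
    have heq : y =ᶠ[𝓝 t] w (|t| + 1) := by
      filter_upwards [Ioi_mem_nhds hlt] with s hs
      exact hyw _ hN s (le_of_lt hs)
    rw [hyw _ hN t hlt.le]
    exact (hw _ t hlt.le).congr_of_eventuallyEq heq

end GeneralODE

section Hull

variable {n m : ℕ}

/-- Fields `h (x, y, τ)` driving the fast variable `y`, with parameter `x`. -/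
abbrev FastField (n m : ℕ) :=
  C(EuclideanSpace ℝ (Fin n) × EuclideanSpace ℝ (Fin m) × ℝ, EuclideanSpace ℝ (Fin m))

theorem IsSolutionOn.timeTranslate {g : FastField n m} {X : ℝ → EuclideanSpace ℝ (Fin n)}
    {u : ℝ → EuclideanSpace ℝ (Fin m)} {s : Set ℝ} (hu : IsSolutionOn g X u s) (a : ℝ) :
    IsSolutionOn (timeTranslate a g) (fun t => X (t + a)) (fun t => u (t + a))
      ((fun t => t + a) ⁻¹' s) :=
  fun t ht => HasDerivAt.comp_add_const t a (hu (t + a) ht)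

theorem lipschitzInState_of_mem_closure {g h : FastField n m} (hg : IsLipschitzInY g)
    (hh : h ∈ closure {h | ∃ s : ℝ, h = timeTranslate s g}) : LipschitzInState h := by
  intro x R
  obtain ⟨L, hL, hLip⟩ := hg {x} isCompact_singleton (closedBall 0 R) (isCompact_closedBall _ _)
  refine ⟨L.toNNReal, fun t => LipschitzOnWith.of_dist_le_mul fun y₁ h₁ y₂ h₂ => ?_⟩
  rw [Real.coe_toNNReal _ hL.le]
  have hcl : IsClosed {h : FastField n m |
      dist (h (x, y₁, t)) (h (x, y₂, t)) ≤ L * dist y₁ y₂} :=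
    isClosed_le ((ContinuousEvalConst.continuous_eval_const _).dist
      (ContinuousEvalConst.continuous_eval_const _)) continuous_const
  refine closure_minimal ?_ hcl hh
  rintro _ ⟨s, rfl⟩
  simpa [timeTranslate, dist_eq_norm] using hLip x rfl y₁ h₁ y₂ h₂ (t + s)

/-- An ultimate bound for the solutions of `g` is inherited by every field in the hull of `g`. -/
theorem norm_le_of_mem_closure {g h : FastField n m}
    (hh : h ∈ closure {h | ∃ s : ℝ, h = timeTranslate s g}) (hL : LipschitzInState h)
    {x : EuclideanSpace ℝ (Fin n)} {c d T : ℝ}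
    (hT : ∀ (τ₀ : ℝ) (y₀ : EuclideanSpace ℝ (Fin m)), ‖y₀‖ ≤ d →
      ∃ u : ℝ → EuclideanSpace ℝ (Fin m), u τ₀ = y₀ ∧ IsSolutionOn g (fun _ => x) u (Ici τ₀) ∧
        ∀ τ ≥ T, ‖u (τ + τ₀)‖ ≤ c)
    (hT0 : 0 ≤ T) {u : ℝ → EuclideanSpace ℝ (Fin m)} {T₀ T₁ : ℝ} (hTT : T₀ + T ≤ T₁)
    (hu : IsSolutionOn h (fun _ => x) u (Icc T₀ T₁)) (hd : ‖u T₀‖ ≤ d) : ‖u T₁‖ ≤ c := by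
  have hne := mem_closure_iff_comap_neBot.1 hh
  choose s hs using fun i : {h | ∃ s : ℝ, h = timeTranslate s g} => i.2
  choose w hw0 hw hwc using fun i => hT (T₀ + s i) (u T₀) hd
  have hcd := eventually_dist_le_of_isSolutionOn hL hu
    (hi := fun i : {h | ∃ s : ℝ, h = timeTranslate s g} => (i : FastField n m)) tendsto_comap
    (S := fun _ => T₁) (fun _ => le_rfl) (X := fun _ _ => x)
    (fun η hη => by simp [hη.le]) (u := fun i t => w i (t + s i))
    (Eventually.of_forall fun i => by
      simp only [hs i]
      refine ((hw i).timeTranslate (s i)).mono fun t ht => ?_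
      simpa using ht.1)
    (by simp only [hw0]; exact tendsto_const_nhds)
  refine le_of_forall_pos_le_add fun η hη => ?_
  obtain ⟨i, hi⟩ := (hcd η hη).exists
  have h1 := hi T₁ ⟨by linarith, le_rfl⟩
  have h2 := hwc i (T₁ - T₀) (by linarith)
  rw [show T₁ - T₀ + (T₀ + s i) = T₁ + s i by ring] at h2
  rw [dist_comm, dist_eq_norm] at h1
  have h3 := norm_add_le (u T₁ - w i (T₁ + s i)) (w i (T₁ + s i))
  rw [sub_add_cancel] at h3
  linarith

/-- A dissipative fast equation with slowly varying parameter has bounded solutions, uniformly in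
the length of the time interval. -/
theorem exists_bound_of_slowly_varying {g : FastField n m} {Hs : Set (FastField n m)}
    (hHs : IsCompact Hs) (htr : ∀ s, timeTranslate s g ∈ Hs)
    (hL : ∀ h ∈ Hs, LipschitzInState h)
    (hex : ∀ h ∈ Hs, ∀ (x : EuclideanSpace ℝ (Fin n)) (τ : ℝ) (y₀ : EuclideanSpace ℝ (Fin m)),
      ∃ u : ℝ → EuclideanSpace ℝ (Fin m), u τ = y₀ ∧ IsSolutionOn h (fun _ => x) u (Ici τ))
    {K : Set (EuclideanSpace ℝ (Fin n))} (hK : IsCompact K) {c : ℝ} (hc : 0 < c)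
    (hdiss : ∀ d > (0 : ℝ), ∃ T > (0 : ℝ), ∀ h ∈ Hs, ∀ x ∈ K,
      ∀ (u : ℝ → EuclideanSpace ℝ (Fin m)) (T₀ T₁ : ℝ), T₀ + T ≤ T₁ →
        IsSolutionOn h (fun _ => x) u (Icc T₀ T₁) → ‖u T₀‖ ≤ d → ‖u T₁‖ ≤ c)
    {S : ℕ → ℝ} {X : ℕ → ℝ → EuclideanSpace ℝ (Fin n)} {u : ℕ → ℝ → EuclideanSpace ℝ (Fin m)}
    (hXK : ∀ᶠ k in atTop, ∀ t ∈ Icc 0 (S k), X k t ∈ K)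
    (hX : ∀ T, ∀ η > 0, ∀ᶠ k in atTop, ∀ s ∈ Icc 0 (S k), ∀ t ∈ Icc 0 (S k), |t - s| ≤ T →
      dist (X k t) (X k s) ≤ η)
    (hu : ∀ k, IsSolutionOn g (X k) (u k) (Icc 0 (S k)))
    {r : ℝ} (hr : ∀ k, ‖u k 0‖ ≤ r) :
    ∃ D, ∀ᶠ k in atTop, ∀ t ∈ Icc 0 (S k), ‖u k t‖ ≤ D := by
  set d := max (c + 1) r with hd
  have hd0 : 0 < d := lt_of_lt_of_le (by linarith) (le_max_left _ _)
  obtain ⟨T, hT, hTd⟩ := hdiss d hd0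
  have hstep : ∃ D, ∀ᶠ k in atTop, ∀ a ∈ Icc 0 (S k), ‖u k a‖ ≤ d →
      (∀ t ∈ Icc 0 (min T (S k - a)), ‖u k (t + a)‖ ≤ D) ∧ (T ≤ S k - a → ‖u k (T + a)‖ ≤ d) := by
    by_contra! hcon
    have hj : ∀ j : ℕ, ∃ k ≥ j, (∀ t ∈ Icc 0 (S k), X k t ∈ K) ∧ ∃ a ∈ Icc 0 (S k), ‖u k a‖ ≤ d ∧
        ((∀ t ∈ Icc 0 (min T (S k - a)), ‖u k (t + a)‖ ≤ j) →
          T ≤ S k - a ∧ d < ‖u k (T + a)‖) := by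
      intro j
      obtain ⟨k, h1, h2, h3⟩ := ((hcon j).and_eventually
        ((eventually_ge_atTop j).and hXK)).exists
      exact ⟨k, h2, h3, h1⟩
    choose k hkj hkK a ha had hbad using hj
    let U : Ultrafilter ℕ := Ultrafilter.of atTop
    have hU : (U : Filter ℕ) ≤ atTop := Ultrafilter.of_le _
    have hkU : Tendsto k U atTop := (tendsto_atTop_mono hkj tendsto_id).mono_left hU
    obtain ⟨h, hh, hhl⟩ := hHs.exists_tendsto_ultrafilter U
      (Eventually.of_forall fun j => htr (a j))
    obtain ⟨x, hx, hxl⟩ := hK.exists_tendsto_ultrafilter U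
      (Eventually.of_forall fun j => hkK j _ (ha j))
    obtain ⟨p, hp, hpl⟩ := (isCompact_closedBall 0 d).exists_tendsto_ultrafilter U
      (Eventually.of_forall fun j => mem_closedBall_zero_iff.2 (had j))
    have hp' : ‖p‖ ≤ d := by simpa using hp
    obtain ⟨v, hv0, hv⟩ := hex h hh x 0 p
    have hv := hv.mono (Icc_subset_Ici_self : Icc 0 T ⊆ Ici 0)
    obtain ⟨M, hM⟩ := isCompact_Icc.exists_bound_of_continuousOn hv.continuousOn
    have hmem : ∀ j, ∀ t ∈ Icc 0 (min T (S (k j) - a j)), t + a j ∈ Icc 0 (S (k j)) := by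
      intro j t ht
      have := ht.2.trans (min_le_right _ _)
      exact ⟨add_nonneg ht.1 (ha j).1, by linarith⟩
    have hcd := eventually_dist_le_of_isSolutionOn (hL h hh) hv hhl
      (S := fun j => min T (S (k j) - a j)) (fun j => min_le_left _ _)
      (X := fun j t => X (k j) (t + a j)) (u := fun j t => u (k j) (t + a j)) ?_
      (Eventually.of_forall fun j => ((hu (k j)).timeTranslate (a j)).mono (hmem j))
      (by simpa [hv0] using hpl) 1 one_pos
    · have hlarge : ∀ᶠ j : ℕ in (U : Filter ℕ), M + 1 ≤ j :=
        hU (tendsto_natCast_atTop_atTop.eventually_ge_atTop (M + 1))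
      obtain ⟨j, hj1, hj2⟩ := (hcd.and hlarge).exists
      have hclose : ∀ t ∈ Icc 0 (min T (S (k j) - a j)), ‖u (k j) (t + a j)‖ ≤ ‖v t‖ + 1 := by
        intro t ht
        have h1 := hj1 t ht
        rw [dist_eq_norm] at h1
        have h3 := norm_add_le (u (k j) (t + a j) - v t) (v t)
        rw [sub_add_cancel] at h3
        linarith
      obtain ⟨hb1, hb2⟩ := hbad j fun t ht => (hclose t ht).trans (by
        have := hM t ⟨ht.1, ht.2.trans (min_le_left _ _)⟩
        linarith)
      have h1 := hclose T ⟨hT.le, by rw [min_eq_left hb1]⟩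
      have h2 := hTd h hh x hx v 0 T (by simp) hv (by rwa [hv0])
      have h3 := le_max_left (c + 1) r
      linarith
    · intro η hη
      filter_upwards [hkU.eventually (hX T (η / 2) (half_pos hη)),
        Metric.tendsto_nhds.1 hxl (η / 2) (half_pos hη)] with j hj1 hj2 t ht
      have h1 := hj1 (a j) (ha j) (t + a j) (hmem j t ht) (by
        rw [add_sub_cancel_right, abs_of_nonneg ht.1]
        exact ht.2.trans (min_le_left _ _))
      linarith [dist_triangle (X (k j) (t + a j)) (X (k j) (a j)) x]
  obtain ⟨D, hD⟩ := hstep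
  refine ⟨D, ?_⟩
  filter_upwards [hD] with k hk t ht
  have hind : ∀ j : ℕ, j * T ≤ S k → ‖u k (j * T)‖ ≤ d := by
    intro j
    induction j with
    | zero => intro _; simpa only [Nat.cast_zero, zero_mul] using (hr k).trans (le_max_right _ _)
    | succ j ih =>
      intro hj
      push_cast at hj ⊢
      have hjT : (j : ℝ) * T ≤ S k := by linarith
      have h1 := (hk (j * T) ⟨by positivity, hjT⟩ (ih hjT)).2 (by linarith)
      rwa [show ((j : ℝ) + 1) * T = T + j * T by ring]
  have h1 : (⌊t / T⌋₊ : ℝ) * T ≤ t :=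
    (le_div_iff₀ hT).1 (Nat.floor_le (div_nonneg ht.1 hT.le))
  have h2 : t < (⌊t / T⌋₊ + 1 : ℝ) * T := (div_lt_iff₀ hT).1 (Nat.lt_floor_add_one _)
  have h3 := (hk (⌊t / T⌋₊ * T) ⟨by positivity, h1.trans ht.2⟩ (hind _ (h1.trans ht.2))).1
    (t - ⌊t / T⌋₊ * T) ⟨by linarith, le_min (by linarith) (by linarith [ht.2])⟩
  rwa [sub_add_cancel] at h3

end Hull

/-- under continuity of x ↦ 𝔸ˣ, the optimal inflation radii δ_k tend to zero together with the distances. -/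
theorem stmt_13
    {n m : ℕ} (hn : 1 ≤ n) (hm : 1 ≤ m)
    -- g, admissible and Lipschitz in y on compacts
    (g : C(EuclideanSpace ℝ (Fin n) × EuclideanSpace ℝ (Fin m) × ℝ,
      EuclideanSpace ℝ (Fin m)))
    (hadm : IsAdmissibleMap g) (hlip : IsLipschitzInY g)
    -- the hull H of g, a compact metric space with the continuous shift flow,
    -- identified via the embedding ev with the closure of the translates of g
    (H : Type) [MetricSpace H] [CompactSpace H]
    (σf : ℝ → H → H)
    (hσcont : Continuous fun p : ℝ × H => σf p.1 p.2)
    (hσ0 : ∀ h, σf 0 h = h)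
    (hσadd : ∀ s t : ℝ, ∀ h, σf (s + t) h = σf s (σf t h))
    (ev : H → C(EuclideanSpace ℝ (Fin n) × EuclideanSpace ℝ (Fin m) × ℝ,
      EuclideanSpace ℝ (Fin m)))
    (hev : Topology.IsEmbedding ev)
    (hrange : Set.range ev = closure {h | ∃ s : ℝ, h = timeTranslate s g})
    (g0 : H) (hg0 : ev g0 = g)
    (hequiv : ∀ (s : ℝ) (h : H), ev (σf s h) = timeTranslate s (ev h))
    -- the (unique, maximal) solutions y(τ,h,x,τ₀,y₀) of y' = h(x,y,τ)
    (sol : H → EuclideanSpace ℝ (Fin n) → ℝ → EuclideanSpace ℝ (Fin m) → ℝ →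
      EuclideanSpace ℝ (Fin m))
    (hsolinit : ∀ h x τ₀ y₀, sol h x τ₀ y₀ τ₀ = y₀)
    -- (H1): all solutions over the hull are globally defined in the future
    (hsolode : ∀ h x (τ₀ : ℝ) y₀ (τ : ℝ), τ₀ ≤ τ →
      HasDerivAt (sol h x τ₀ y₀) (ev h (x, sol h x τ₀ y₀ τ, τ)) τ)
    -- (H2): uniform ultimate boundedness over compact sets of parameters
    (hH2 : ∀ K₀ : Set (EuclideanSpace ℝ (Fin n)), IsCompact K₀ →
      ∃ c > (0:ℝ), ∀ d > (0:ℝ), ∃ T > (0:ℝ), ∀ x ∈ K₀, ∀ τ₀ : ℝ, ∀ τ ≥ T,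
        ∀ y₀ : EuclideanSpace ℝ (Fin m), ‖y₀‖ ≤ d → ‖sol g0 x τ₀ y₀ (τ + τ₀)‖ ≤ c)
    -- the slow vector field f, continuous and of linear growth
    (f : EuclideanSpace ℝ (Fin n) → EuclideanSpace ℝ (Fin m) → EuclideanSpace ℝ (Fin n))
    (hf : Continuous fun p : EuclideanSpace ℝ (Fin n) × EuclideanSpace ℝ (Fin m) =>
      f p.1 p.2)
    (a b : ℝ) (ha : 0 < a) (hb : 0 < b)
    (hgrowth : ∀ x y, ‖f x y‖ ≤ a + b * ‖x‖)
    -- initial data, final slow time, the sequence ε_k ↓ 0, and the solutions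
    -- (x_{ε_k}, y_{ε_k}) of the slow-fast system in the fast time
    (xInit : EuclideanSpace ℝ (Fin n)) (yInit : EuclideanSpace ℝ (Fin m))
    (t₀ : ℝ) (ht₀ : 0 < t₀)
    (ε : ℕ → ℝ) (hεpos : ∀ k, 0 < ε k) (hεanti : StrictAnti ε)
    (hεlim : Tendsto ε atTop (𝓝 0))
    (xe : ℕ → ℝ → EuclideanSpace ℝ (Fin n)) (ye : ℕ → ℝ → EuclideanSpace ℝ (Fin m))
    (hxe0 : ∀ k, xe k 0 = xInit) (hye0 : ∀ k, ye k 0 = yInit)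
    (hxeode : ∀ k : ℕ, ∀ τ ∈ Set.Icc (0:ℝ) (t₀ / ε k),
      HasDerivAt (xe k) (ε k • f (xe k τ) (ye k τ)) τ)
    (hyeode : ∀ k : ℕ, ∀ τ ∈ Set.Icc (0:ℝ) (t₀ / ε k),
      HasDerivAt (ye k) (g (xe k τ, ye k τ, τ)) τ)
    -- the slow components converge uniformly (in the slow time) to x₀
    (x0 : ℝ → EuclideanSpace ℝ (Fin n)) (hx0cont : ContinuousOn x0 (Set.Icc 0 t₀))
    (hconv : TendstoUniformlyOn (fun k t => xe k (t / ε k)) x0 atTop (Set.Icc 0 t₀))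
    -- the radius of the compact tube K₀ around x₀
    (r : ℝ) (hr : 0 < r)
    -- continuity of x ↦ 𝔸ˣ for the Hausdorff distance
    (hcont : ∀ x ∈ slowTube x0 t₀ r,
      Tendsto (fun x' => Metric.hausdorffDist
          {p : H × EuclideanSpace ℝ (Fin m) | p.2 ∈ attrFiber ev p.1 x'}
          {p : H × EuclideanSpace ℝ (Fin m) | p.2 ∈ attrFiber ev p.1 x})
        (𝓝[slowTube x0 t₀ r] x) (𝓝 0))
 :
    ∀ dk : ℕ → ℝ,
      (∀ k : ℕ, dk k = sInf {δ : ℝ | 0 < δ ∧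
        Metric.infDist (ye k (t₀ / ε k))
          (inflFiberH ev (σf (t₀ / ε k) g0) (x0 t₀) δ) ≤ δ}) →
      Tendsto dk atTop (𝓝 0) ∧
      Tendsto (fun k : ℕ => Metric.infDist (ye k (t₀ / ε k))
          (inflFiberH ev (σf (t₀ / ε k) g0) (x0 t₀) (dk k))) atTop (𝓝 0) := by
  intro dk hdk
  have hmem : ∀ h : H, ev h ∈ closure {h | ∃ s : ℝ, h = timeTranslate s g} := fun h =>
    hrange ▸ mem_range_self h
  have hL : ∀ h : H, LipschitzInState (ev h) := fun h =>
    lipschitzInState_of_mem_closure hlip (hmem h)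
  have hex : ∀ (h : H) (x : EuclideanSpace ℝ (Fin n)) (τ : ℝ) (y₀ : EuclideanSpace ℝ (Fin m)),
      ∃ u : ℝ → EuclideanSpace ℝ (Fin m), u τ = y₀ ∧
        IsSolutionOn (ev h) (fun _ => x) u (Ici τ) := fun h x τ y₀ =>
    ⟨sol h x τ y₀, hsolinit h x τ y₀, fun t ht => hsolode h x τ y₀ t ht⟩
  have hτ : ∀ k, 0 < t₀ / ε k := fun k => div_pos ht₀ (hεpos k)
  have hτlim : Tendsto (fun k => t₀ / ε k) atTop atTop :=
    Tendsto.const_mul_atTop ht₀ (tendsto_inv_nhdsGT_zero.comp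
      (tendsto_nhdsWithin_iff.2 ⟨hεlim, Eventually.of_forall hεpos⟩))
  -- the slow components stay in a ball
  obtain ⟨R₀, hR₀⟩ := isCompact_Icc.exists_bound_of_continuousOn hx0cont
  have hR₀0 : 0 ≤ R₀ := (norm_nonneg _).trans (hR₀ t₀ ⟨ht₀.le, le_rfl⟩)
  have hxball : ∀ᶠ k in atTop, ∀ t ∈ Icc 0 (t₀ / ε k),
      xe k t ∈ closedBall (0 : EuclideanSpace ℝ (Fin n)) (R₀ + 1) := by
    filter_upwards [Metric.tendstoUniformlyOn_iff.1 hconv 1 one_pos] with k hk t ht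
    have hm : ε k * t ∈ Icc 0 t₀ := ⟨mul_nonneg (hεpos k).le ht.1, by
      have := (le_div_iff₀ (hεpos k)).1 ht.2
      linarith⟩
    have h1 := hk _ hm
    rw [mul_div_cancel_left₀ _ (hεpos k).ne', dist_comm, dist_eq_norm] at h1
    have h2 := norm_add_le (xe k t - x0 (ε k * t)) (x0 (ε k * t))
    rw [sub_add_cancel] at h2
    rw [mem_closedBall_zero_iff]
    linarith [hR₀ _ hm]
  have hxslow : ∀ T, ∀ η > 0, ∀ᶠ k in atTop, ∀ s ∈ Icc 0 (t₀ / ε k), ∀ t ∈ Icc 0 (t₀ / ε k),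
      |t - s| ≤ T → dist (xe k t) (xe k s) ≤ η := by
    intro T η hη
    have hlim : Tendsto (fun k => ε k * (a + b * (R₀ + 1)) * T) atTop (𝓝 0) := by
      simpa using (hεlim.mul_const (a + b * (R₀ + 1))).mul_const T
    filter_upwards [hxball, hlim.eventually_lt_const hη] with k hk hk2 s hs t ht hst
    have hmv := (convex_Icc 0 (t₀ / ε k)).norm_image_sub_le_of_norm_hasDerivWithin_le
      (C := ε k * (a + b * (R₀ + 1))) (fun τ hτ => (hxeode k τ hτ).hasDerivWithinAt)
      (fun τ hτ => by
        rw [norm_smul, Real.norm_of_nonneg (hεpos k).le]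
        have h1 := mem_closedBall_zero_iff.1 (hk τ hτ)
        exact mul_le_mul_of_nonneg_left ((hgrowth _ _).trans (by gcongr)) (hεpos k).le) hs ht
    rw [dist_eq_norm]
    have h0 : 0 ≤ ε k * (a + b * (R₀ + 1)) :=
      mul_nonneg (hεpos k).le (by positivity)
    rw [Real.norm_eq_abs] at hmv
    exact hmv.trans ((mul_le_mul_of_nonneg_left hst h0).trans hk2.le)
  -- dissipativity over the hull
  obtain ⟨c, hc, hcT⟩ := hH2 (closedBall 0 (R₀ + 1)) (isCompact_closedBall _ _)
  have hdiss : ∀ d > (0 : ℝ), ∃ T > (0 : ℝ), ∀ h ∈ range ev,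
      ∀ x ∈ closedBall (0 : EuclideanSpace ℝ (Fin n)) (R₀ + 1),
      ∀ (u : ℝ → EuclideanSpace ℝ (Fin m)) (T₀ T₁ : ℝ), T₀ + T ≤ T₁ →
        IsSolutionOn h (fun _ => x) u (Icc T₀ T₁) → ‖u T₀‖ ≤ d → ‖u T₁‖ ≤ c := by
    intro d hd
    obtain ⟨T, hT, hTc⟩ := hcT d hd
    refine ⟨T, hT, ?_⟩
    rintro _ ⟨h, rfl⟩ x hx u T₀ T₁ hTT hu hud
    exact norm_le_of_mem_closure (hmem h) (hL h) (x := x) (d := d) (T := T)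
      (fun τ₀ y₀ hy₀ => ⟨sol g0 x τ₀ y₀, hsolinit _ _ _ _,
        fun t ht => hg0 ▸ hsolode g0 x τ₀ y₀ t ht, fun τ hτ => hTc x hx τ₀ τ hτ y₀ hy₀⟩)
      hT.le hTT hu hud
  obtain ⟨D, hD⟩ := exists_bound_of_slowly_varying (g := g) (S := fun k => t₀ / ε k)
    (isCompact_range hev.continuous)
    (fun s => ⟨σf s g0, by rw [hequiv, hg0]⟩) (by rintro _ ⟨h, rfl⟩; exact hL h)
    (by rintro _ ⟨h, rfl⟩; exact hex h) (isCompact_closedBall _ _) hc hdiss hxball hxslow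
    (u := ye) (fun k t ht => hyeode k t ht) (r := ‖yInit‖) (fun k => by rw [hye0])
  have hx0ball : x0 t₀ ∈ closedBall (0 : EuclideanSpace ℝ (Fin n)) (R₀ + 1) :=
    mem_closedBall_zero_iff.2 ((hR₀ t₀ ⟨ht₀.le, le_rfl⟩).trans (by linarith))
  have hfwd : ∀ (h : H) (u : ℝ → EuclideanSpace ℝ (Fin m)),
      IsSolutionOn (ev h) (fun _ => x0 t₀) u (Ici 0) → ∃ C, ∀ t ≥ 0, ‖u t‖ ≤ C := by
    intro h u hu
    obtain ⟨T, hT, hTd⟩ := hdiss (‖u 0‖ + 1) (by positivity)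
    obtain ⟨C, hC⟩ := isCompact_Icc.exists_bound_of_continuousOn
      (hu.mono (Icc_subset_Ici_self : Icc 0 T ⊆ Ici 0)).continuousOn
    refine ⟨max C c, fun t ht => ?_⟩
    rcases le_or_gt t T with htT | htT
    · exact (hC t ⟨ht, htT⟩).trans (le_max_left _ _)
    · exact (hTd _ ⟨h, rfl⟩ _ hx0ball u 0 t (by linarith) (hu.mono Icc_subset_Ici_self)
        (by linarith)).trans (le_max_right _ _)
  have hxend : Tendsto (fun k => xe k (t₀ / ε k)) atTop (𝓝 (x0 t₀)) :=
    hconv.tendsto_at ⟨ht₀.le, le_rfl⟩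
  have hclose : ∀ η > 0, ∀ᶠ k in atTop, Metric.infDist (ye k (t₀ / ε k))
      (inflFiberH ev (σf (t₀ / ε k) g0) (x0 t₀) η) ≤ η := by
    intro η hη
    by_contra hcon
    have hne := frequently_iff_neBot.1 (not_eventually.1 hcon)
    obtain ⟨U, hU⟩ := Ultrafilter.exists_le (atTop ⊓ 𝓟 {k | ¬ Metric.infDist (ye k (t₀ / ε k))
      (inflFiberH ev (σf (t₀ / ε k) g0) (x0 t₀) η) ≤ η})
    have hUtop : (U : Filter ℕ) ≤ atTop := hU.trans inf_le_left
    have hUbad := le_principal_iff.1 (hU.trans inf_le_right)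
    obtain ⟨h, -, hh⟩ := isCompact_univ.exists_tendsto_ultrafilter U
      (f := fun k => σf (t₀ / ε k) g0) (Eventually.of_forall fun _ => mem_univ _)
    have hsub : ∀ N, ∀ᶠ k in (U : Filter ℕ), ∀ t ∈ Icc (-N) 0,
        t + t₀ / ε k ∈ Icc 0 (t₀ / ε k) := by
      intro N
      filter_upwards [hUtop (hτlim.eventually_ge_atTop N)] with k hk t ht
      exact ⟨by linarith [ht.1], by linarith [ht.2]⟩
    obtain ⟨y, hy0, hyb, hy⟩ := exists_entire_solution_of_ultrafilter (U := U) (hL h)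
      (hex h (x0 t₀)) (hfwd h) ((hev.continuous.tendsto h).comp hh)
      (X := fun k t => xe k (t + t₀ / ε k)) (u := fun k t => ye k (t + t₀ / ε k)) (D := D)
      (fun N η hη => by
        filter_upwards [hsub N, hUtop (hxslow N (η / 2) (half_pos hη)),
          hUtop (Metric.tendsto_nhds.1 hxend (η / 2) (half_pos hη))] with k h1 h2 h3 t ht
        have h4 := h2 _ ⟨(hτ k).le, le_rfl⟩ _ (h1 t ht) (by
          rw [add_sub_cancel_right, abs_of_nonpos ht.2]
          linarith [ht.1])
        linarith [dist_triangle (xe k (t + t₀ / ε k)) (xe k (t₀ / ε k)) (x0 t₀)])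
      (fun N => by
        filter_upwards [hsub N] with k hk
        have h1 : IsSolutionOn g (xe k) (ye k) (Icc 0 (t₀ / ε k)) :=
          fun t ht => hyeode k t ht
        have h2 := (h1.timeTranslate (t₀ / ε k)).mono hk
        rwa [← hg0, ← hequiv] at h2)
      (fun N => by
        filter_upwards [hsub N, hUtop hD] with k h1 h2 t ht
        exact h2 _ (h1 t ht))
    have hyA : y 0 ∈ attrFiber ev h (x0 t₀) := ⟨y, rfl, hyb, fun t => hy t (mem_univ t)⟩
    simp only [zero_add] at hy0
    obtain ⟨k, hk1, hk2, hk3⟩ := ((Metric.tendsto_nhds.1 hy0 η hη).and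
      ((Metric.tendsto_nhds.1 hh η hη).and hUbad)).exists
    refine hk3 ((Metric.infDist_le_dist_of_mem ?_).trans hk1.le)
    rw [dist_comm] at hk2
    exact mem_iUnion₂.2 ⟨h, hk2.le, hyA⟩
  have hbdd : ∀ k, BddBelow {δ : ℝ | 0 < δ ∧ Metric.infDist (ye k (t₀ / ε k))
      (inflFiberH ev (σf (t₀ / ε k) g0) (x0 t₀) δ) ≤ δ} := fun k => ⟨0, fun δ hδ => hδ.1.le⟩
  have hdk0 : ∀ k, 0 ≤ dk k := fun k => by
    rw [hdk]
    exact Real.sInf_nonneg fun δ hδ => hδ.1.le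
  have hdlim : Tendsto dk atTop (𝓝 0) := by
    rw [Metric.tendsto_nhds]
    intro η hη
    filter_upwards [hclose (η / 2) (half_pos hη)] with k hk
    rw [Real.dist_0_eq_abs, abs_of_nonneg (hdk0 k), hdk]
    exact (csInf_le (hbdd k) ⟨half_pos hη, hk⟩).trans_lt (half_lt_self hη)
  refine ⟨hdlim, squeeze_zero' (Eventually.of_forall fun k => Metric.infDist_nonneg) ?_ hdlim⟩
  -- the infimum is attained, by compactness of the attractor
  filter_upwards [hclose 1 one_pos] with k hk
  rcases (inflFiberH ev (σf (t₀ / ε k) g0) (x0 t₀) (dk k)).eq_empty_or_nonempty with he | hne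
  · rw [he, Metric.infDist_empty]
    exact hdk0 k
  have hSne : {δ : ℝ | 0 < δ ∧ Metric.infDist (ye k (t₀ / ε k))
      (inflFiberH ev (σf (t₀ / ε k) g0) (x0 t₀) δ) ≤ δ}.Nonempty := ⟨1, one_pos, hk⟩
  have hseq : ∀ j : ℕ, ∃ h z, dist h (σf (t₀ / ε k) g0) ≤ dk k + 1 / ((j : ℝ) + 1) ∧
      z ∈ attrFiber ev h (x0 t₀) ∧
      dist (ye k (t₀ / ε k)) z ≤ dk k + 1 / ((j : ℝ) + 1) + 1 / ((j : ℝ) + 1) := by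
    intro j
    have hj : (0 : ℝ) < 1 / ((j : ℝ) + 1) := by positivity
    have hS : sInf {δ : ℝ | 0 < δ ∧ Metric.infDist (ye k (t₀ / ε k))
        (inflFiberH ev (σf (t₀ / ε k) g0) (x0 t₀) δ) ≤ δ} < dk k + 1 / ((j : ℝ) + 1) := by
      rw [← hdk]
      exact lt_add_of_pos_right _ hj
    obtain ⟨δ, ⟨hδ0, hδ⟩, hlt⟩ := exists_lt_of_csInf_lt hSne hS
    have hle : dk k ≤ δ := by
      rw [hdk]
      exact csInf_le (hbdd k) ⟨hδ0, hδ⟩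
    have hne' : (inflFiberH ev (σf (t₀ / ε k) g0) (x0 t₀) δ).Nonempty :=
      hne.mono (biUnion_subset_biUnion_left fun h' hh' => le_trans hh' hle)
    obtain ⟨z, hz, hzd⟩ := (Metric.infDist_lt_iff hne').1
      (hδ.trans_lt (lt_add_of_pos_right δ hj))
    obtain ⟨h, hh, hzA⟩ := mem_iUnion₂.1 hz
    exact ⟨h, z, le_trans hh hlt.le, hzA, by linarith⟩
  choose h z hh hz hzd using hseq
  choose w hw0 hwb hw using hz
  let U : Ultrafilter ℕ := Ultrafilter.of atTop
  have hUtop : (U : Filter ℕ) ≤ atTop := Ultrafilter.of_le _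
  have hone : Tendsto (fun j : ℕ => 1 / ((j : ℝ) + 1)) U (𝓝 0) :=
    tendsto_one_div_add_atTop_nhds_zero_nat.mono_left hUtop
  obtain ⟨h', -, hh'⟩ := isCompact_univ.exists_tendsto_ultrafilter U
    (f := h) (Eventually.of_forall fun _ => mem_univ _)
  have hwc : ∀ j t, ‖w j t‖ ≤ c := by
    intro j t
    obtain ⟨C, hC⟩ := hwb j
    obtain ⟨T, hT, hTd⟩ := hdiss (max C 1) (by positivity)
    exact hTd _ ⟨h j, rfl⟩ _ hx0ball (w j) (t - T) t (by linarith) (fun s _ => hw j s)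
      ((hC _).trans (le_max_left _ _))
  obtain ⟨y, hy0, hyb, hy⟩ := exists_entire_solution_of_ultrafilter (U := U) (hL h')
    (hex h' (x0 t₀)) (hfwd h') ((hev.continuous.tendsto h').comp hh')
    (X := fun _ _ => x0 t₀) (u := w) (D := c)
    (fun N η hη => by simp [le_of_lt hη])
    (fun N => Eventually.of_forall fun j s _ => hw j s)
    (fun N => Eventually.of_forall fun j s _ => hwc j s)
  simp only [hw0] at hy0
  have hd1 : dist h' (σf (t₀ / ε k) g0) ≤ dk k :=
    le_of_tendsto_of_tendsto (hh'.dist tendsto_const_nhds)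
      (by simpa using hone.const_add (dk k)) (Eventually.of_forall hh)
  have hd2 : dist (ye k (t₀ / ε k)) (y 0) ≤ dk k :=
    le_of_tendsto_of_tendsto (tendsto_const_nhds.dist hy0)
      (by simpa using (hone.const_add (dk k)).add hone) (Eventually.of_forall hzd)
  have hyA : y 0 ∈ attrFiber ev h' (x0 t₀) := ⟨y, rfl, hyb, fun t => hy t (mem_univ t)⟩
  exact (Metric.infDist_le_dist_of_mem (mem_iUnion₂.2 ⟨h', hd1, hyA⟩)).trans hd2
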